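/- arXiv:1806.08510 — 2 statements merged into one kernel-verified Lean document; each statement's English description precedes it below -/
import Mathlib

section
/- The function Q(x) = 3^{1/4}(1+|x|^2)^{-1/2} on ℝ³ is a positive, radially symmetric, smooth function with Q(0) = 3^{1/4} and ∫_{ℝ³}|∇Q(x)|² dx < ∞, and it satisfies the equation -ΔQ(x) = Q(x)⁵ at every point x ∈ ℝ³. -/
open MeasureTheory
open scoped RealInnerProductSpace

noncomputable section

/-- Euclidean space `ℝ³`. -/
abbrev R3 : Type := EuclideanSpace ℝ (Fin 3)

/-- The Laplacian `Δu = ∑ᵢ ∂²u/∂xᵢ²` on `ℝ³`. -/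
noncomputable def lap (u : R3 → ℝ) (x : R3) : ℝ :=
  ∑ i : Fin 3,
    fderiv ℝ (fun y => fderiv ℝ u y (EuclideanSpace.single i 1)) x (EuclideanSpace.single i 1)

/-- The Aubin–Talenti bubble `Q(x) = 3^(1/4) (1 + |x|²)^(-1/2)` on `ℝ³`. -/
noncomputable def Qb (x : R3) : ℝ := (3 : ℝ) ^ ((1 : ℝ) / 4) * (1 + ‖x‖ ^ 2) ^ (-(1 : ℝ) / 2)

theorem hasFDerivAt_one_add_norm_sq_rpow {E : Type*} [NormedAddCommGroup E]
    [InnerProductSpace ℝ E] (a : ℝ) (x : E) :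
    HasFDerivAt (fun y : E => (1 + ‖y‖ ^ 2) ^ a)
      ((2 * a * (1 + ‖x‖ ^ 2) ^ (a - 1)) • innerSL ℝ x) x := by
  have h := ((hasStrictFDerivAt_norm_sq x).hasFDerivAt.const_add 1).rpow_const (p := a)
    (Or.inl (by positivity))
  convert h using 1
  ext v
  simp
  ring

theorem Qb_pos (x : R3) : 0 < Qb x := by
  unfold Qb
  positivity

theorem contDiff_Qb {n : WithTop ℕ∞} : ContDiff ℝ n Qb := by
  unfold Qb
  refine contDiff_const.mul (ContDiff.rpow_const_of_ne ?_ fun x => by positivity)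
  exact contDiff_const.add (contDiff_norm_sq ℝ)

theorem hasFDerivAt_Qb (x : R3) :
    HasFDerivAt Qb ((-(3 : ℝ) ^ ((1 : ℝ) / 4) * (1 + ‖x‖ ^ 2) ^ (-(3 : ℝ) / 2)) • innerSL ℝ x)
      x := by
  have h := (hasFDerivAt_one_add_norm_sq_rpow (-(1 : ℝ) / 2) x).const_mul
    ((3 : ℝ) ^ ((1 : ℝ) / 4))
  rw [show (-(1 : ℝ) / 2 - 1) = -(3 : ℝ) / 2 by norm_num, smul_smul] at h
  exact h.congr_fderiv (congrArg (· • innerSL ℝ x) (by ring))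

theorem norm_gradient_Qb_sq (x : R3) :
    ‖gradient Qb x‖ ^ 2 =
      ((3 : ℝ) ^ ((1 : ℝ) / 4)) ^ 2 * (‖x‖ ^ 2 * (1 + ‖x‖ ^ 2) ^ (-(3 : ℝ))) := by
  rw [gradient, LinearIsometryEquiv.norm_map, (hasFDerivAt_Qb x).fderiv, norm_smul,
    innerSL_apply_norm, mul_pow, Real.norm_eq_abs, sq_abs, mul_pow, neg_sq,
    ← Real.rpow_natCast ((1 + ‖x‖ ^ 2) ^ (-(3 : ℝ) / 2)) 2, ← Real.rpow_mul (by positivity)]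
  norm_num
  ring

theorem integrable_norm_gradient_Qb_sq : Integrable (fun x : R3 => ‖gradient Qb x‖ ^ 2) := by
  have hd : (Module.finrank ℝ R3 : ℝ) < 4 := by simp; norm_num
  have hI := (integrable_rpow_neg_one_add_norm_sq (μ := (volume : Measure R3)) hd).const_mul
    (((3 : ℝ) ^ ((1 : ℝ) / 4)) ^ 2)
  simp only [norm_gradient_Qb_sq]
  refine hI.mono' ?_ (Filter.Eventually.of_forall fun x => ?_)
  · refine Continuous.aestronglyMeasurable ?_
    refine continuous_const.mul ((continuous_norm.pow 2).mul ?_)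
    exact (continuous_const.add (continuous_norm.pow 2)).rpow_const
      fun x => Or.inl (by positivity : 1 + ‖x‖ ^ 2 ≠ 0)
  · have hx : 0 < 1 + ‖x‖ ^ 2 := by positivity
    rw [Real.norm_of_nonneg (by positivity)]
    gcongr
    rw [show (-4 / 2 : ℝ) = 1 + -3 by norm_num, Real.rpow_add hx, Real.rpow_one]
    gcongr
    linarith

theorem fderiv_fderiv_Qb_single (x : R3) (i : Fin 3) :
    fderiv ℝ (fun y => fderiv ℝ Qb y (EuclideanSpace.single i 1)) x
        (EuclideanSpace.single i 1) =
      (3 : ℝ) ^ ((1 : ℝ) / 4) * (3 * (1 + ‖x‖ ^ 2) ^ (-(5 : ℝ) / 2) * x i ^ 2 -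
        (1 + ‖x‖ ^ 2) ^ (-(3 : ℝ) / 2)) := by
  have hfun : (fun y => fderiv ℝ Qb y (EuclideanSpace.single i 1)) =
      fun y : R3 => -(3 : ℝ) ^ ((1 : ℝ) / 4) * ((1 + ‖y‖ ^ 2) ^ (-(3 : ℝ) / 2) * y i) := by
    funext y
    rw [(hasFDerivAt_Qb y).fderiv]
    simp [EuclideanSpace.inner_single_right, mul_assoc]
  have hp := hasFDerivAt_one_add_norm_sq_rpow (-(3 : ℝ) / 2) x
  have hi : HasFDerivAt (fun y : R3 => y i) (EuclideanSpace.proj i : R3 →L[ℝ] ℝ) x :=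
    (EuclideanSpace.proj i : R3 →L[ℝ] ℝ).hasFDerivAt
  have hf := (hp.fun_mul hi).const_mul (-(3 : ℝ) ^ ((1 : ℝ) / 4))
  rw [hfun, hf.fderiv,
    show (-(3 : ℝ) / 2 - 1) = -(5 : ℝ) / 2 by norm_num]
  simp [EuclideanSpace.inner_single_right]
  ring

theorem neg_lap_Qb (x : R3) : -lap Qb x = Qb x ^ 5 := by
  have hx : 0 < 1 + ‖x‖ ^ 2 := by positivity
  have hn : ‖x‖ ^ 2 = x 0 ^ 2 + x 1 ^ 2 + x 2 ^ 2 := by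
    simp [EuclideanSpace.norm_sq_eq, Fin.sum_univ_three]
  have h3 : ((3 : ℝ) ^ ((1 : ℝ) / 4)) ^ 4 = 3 := by
    rw [← Real.rpow_natCast, ← Real.rpow_mul (by norm_num)]
    norm_num
  have h5 : ((1 + ‖x‖ ^ 2) ^ (-(1 : ℝ) / 2)) ^ 5 = (1 + ‖x‖ ^ 2) ^ (-(5 : ℝ) / 2) := by
    rw [← Real.rpow_natCast, ← Real.rpow_mul hx.le]
    norm_num
  have hs : (1 + ‖x‖ ^ 2) ^ (-(3 : ℝ) / 2) =
      (1 + ‖x‖ ^ 2) * (1 + ‖x‖ ^ 2) ^ (-(5 : ℝ) / 2) := by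
    rw [show (-(3 : ℝ) / 2) = 1 + -(5 : ℝ) / 2 by norm_num, Real.rpow_add hx, Real.rpow_one]
  simp only [lap, fderiv_fderiv_Qb_single, Fin.sum_univ_three]
  rw [Qb, mul_pow, h5, pow_succ _ 4, h3, hs]
  generalize (1 + ‖x‖ ^ 2) ^ (-(5 : ℝ) / 2) = t
  rw [hn]
  ring

/-- `Q(x) = 3^(1/4)(1+|x|²)^(-1/2)` is a positive, radially symmetric, smooth
function on `ℝ³` with `Q(0) = 3^(1/4)` and finite Dirichlet energy, satisfying
`-ΔQ = Q⁵` pointwise on `ℝ³`. -/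
theorem aubin_talenti_bubble_properties :
    (∀ x : R3, 0 < Qb x) ∧
    (∀ x y : R3, ‖x‖ = ‖y‖ → Qb x = Qb y) ∧
    ContDiff ℝ (⊤ : ℕ∞) Qb ∧
    Qb 0 = (3 : ℝ) ^ ((1 : ℝ) / 4) ∧
    Integrable (fun x : R3 => ‖gradient Qb x‖ ^ 2) ∧
    (∀ x : R3, -lap Qb x = Qb x ^ 5) := by
  refine ⟨Qb_pos, fun x y h => by rw [Qb, Qb, h], contDiff_Qb, by simp [Qb],
    integrable_norm_gradient_Qb_sq, neg_lap_Qb⟩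
end
end

section
/- Let a, b > 0, let u be a positive C² solution of the Kirchhoff equation -(a + b∫_{ℝ³}|∇u|² dx) Δu = u⁵ in ℝ³ with ∫_{ℝ³}|∇u|² dx < ∞, and let e₀(x) = u(x)/2 + x·∇u(x). Then e₀ satisfies the linearized Kirchhoff equation L₊e₀ = 0, that is, -(a + b∫_{ℝ³}|∇u|² dx) Δe₀(x) - 2b(∫_{ℝ³}∇u·∇e₀ dx) Δu(x) - 5u(x)⁴ e₀(x) = 0 for every x ∈ ℝ³. -/
open MeasureTheory
open scoped RealInnerProductSpace

noncomputable section

/-! ### Directional derivatives -/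

section DirectionalDerivatives

variable {E : Type*} [NormedAddCommGroup E] [NormedSpace ℝ E]

theorem contDiff_fderiv_apply_const {n m : ℕ} {f : E → ℝ} (hf : ContDiff ℝ n f) (h : m + 1 ≤ n)
    (v : E) : ContDiff ℝ m (fun x => fderiv ℝ f x v) :=
  (hf.fderiv_right (by exact_mod_cast h)).clm_apply contDiff_const

theorem fderiv_fderiv_apply {f : E → ℝ} (hf : ContDiff ℝ 2 f) (x v w : E) :
    fderiv ℝ (fun y => fderiv ℝ f y v) x w = fderiv ℝ (fderiv ℝ f) x w v := by
  have h : DifferentiableAt ℝ (fderiv ℝ f) x :=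
    (hf.fderiv_right (m := 1) (by norm_num)).differentiable (by norm_num) x
  rw [fderiv_clm_apply h (differentiableAt_const v)]
  simp

theorem fderiv_fderiv_comm {f : E → ℝ} (hf : ContDiff ℝ 2 f) (x v w : E) :
    fderiv ℝ (fun y => fderiv ℝ f y v) x w = fderiv ℝ (fun y => fderiv ℝ f y w) x v := by
  rw [fderiv_fderiv_apply hf, fderiv_fderiv_apply hf]
  exact hf.contDiffAt.isSymmSndFDerivAt (by simp) w v

/-- The radial (Euler) derivative `x · ∇f(x)` satisfies `∂ᵥ (x · ∇f) = ∂ᵥ f + x · ∇ (∂ᵥ f)`. -/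
theorem fderiv_fderiv_apply_self {f : E → ℝ} (hf : ContDiff ℝ 2 f) (x v : E) :
    fderiv ℝ (fun y => fderiv ℝ f y y) x v =
      fderiv ℝ f x v + fderiv ℝ (fun y => fderiv ℝ f y v) x x := by
  have h : DifferentiableAt ℝ (fderiv ℝ f) x :=
    (hf.fderiv_right (m := 1) (by norm_num)).differentiable (by norm_num) x
  rw [fderiv_clm_apply h differentiableAt_fun_id, fderiv_fderiv_apply hf]
  simpa using hf.contDiffAt.isSymmSndFDerivAt (by simp) v x

end DirectionalDerivatives

theorem clm_apply_eq_sum (T : R3 →L[ℝ] ℝ) (x : R3) :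
    T x = ∑ i : Fin 3, x i * T (EuclideanSpace.single i 1) := by
  conv_lhs => rw [← (EuclideanSpace.basisFun (Fin 3) ℝ).sum_repr x]
  simp

/-! ### Integrals over a compact set depending on a parameter -/

section ParametricIntegrals

variable {X Z : Type*} [NormedAddCommGroup X] [NormedSpace ℝ X] [FiniteDimensional ℝ X]
  [NormedAddCommGroup Z] [NormedSpace ℝ Z] [MeasurableSpace Z] [BorelSpace Z]
  {μ : Measure Z} [IsLocallyFiniteMeasure μ] {K : Set Z}

theorem hasFDerivAt_setIntegral_of_contDiff (hK : IsCompact K) {F : X × Z → ℝ}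
    (hF : ContDiff ℝ 1 F) (x : X) :
    HasFDerivAt (fun x => ∫ z in K, F (x, z) ∂μ)
      (∫ z in K, (fderiv ℝ F (x, z)).comp (ContinuousLinearMap.inl ℝ X Z) ∂μ) x := by
  have hF' : Continuous fun p : X × Z =>
      (fderiv ℝ F p).comp (ContinuousLinearMap.inl ℝ X Z) :=
    (hF.continuous_fderiv (by norm_num)).clm_comp continuous_const
  have hfin : IsFiniteMeasure (μ.restrict K) := ⟨by simpa using hK.measure_lt_top⟩
  obtain ⟨C, hC⟩ := ((isCompact_closedBall x 1).prod hK).exists_bound_of_continuousOn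
    hF'.continuousOn
  refine hasFDerivAt_integral_of_dominated_of_fderiv_le (bound := fun _ => C)
    (F' := fun x z => (fderiv ℝ F (x, z)).comp (ContinuousLinearMap.inl ℝ X Z))
    (Metric.ball_mem_nhds x one_pos) ?_ ?_ ?_ ?_ (integrable_const C) ?_
  · exact Filter.Eventually.of_forall fun y =>
      (hF.continuous.comp (by fun_prop : Continuous fun z : Z => (y, z))).aestronglyMeasurable
  · exact (hF.continuous.comp
      (by fun_prop : Continuous fun z : Z => (x, z))).continuousOn.integrableOn_compact hK
  · exact (hF'.comp (by fun_prop : Continuous fun z : Z => (x, z))).aestronglyMeasurable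
  · refine (ae_restrict_iff' hK.measurableSet).2 (Filter.Eventually.of_forall fun z hz y hy => ?_)
    exact hC (y, z) ⟨Metric.ball_subset_closedBall hy, hz⟩
  · refine Filter.Eventually.of_forall fun z y _ => ?_
    exact ((hF.differentiable (by norm_num)) (y, z)).hasFDerivAt.comp y
      (hasFDerivAt_prodMk_left y z)

theorem fderiv_setIntegral_of_contDiff (hK : IsCompact K) {F : X × Z → ℝ}
    (hF : ContDiff ℝ 1 F) (x v : X) :
    fderiv ℝ (fun x => ∫ z in K, F (x, z) ∂μ) x v = ∫ z in K, fderiv ℝ F (x, z) (v, 0) ∂μ := by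
  rw [(hasFDerivAt_setIntegral_of_contDiff hK hF x).fderiv, ContinuousLinearMap.integral_apply]
  · simp
  · have hF' : Continuous fun z : Z =>
        (fderiv ℝ F (x, z)).comp (ContinuousLinearMap.inl ℝ X Z) :=
      ((hF.continuous_fderiv (by norm_num)).comp
        (by fun_prop : Continuous fun z : Z => (x, z))).clm_comp continuous_const
    exact hF'.continuousOn.integrableOn_compact hK

theorem contDiff_setIntegral (hK : IsCompact K) (n : ℕ) {F : X × Z → ℝ}
    (hF : ContDiff ℝ n F) : ContDiff ℝ n (fun x => ∫ z in K, F (x, z) ∂μ) := by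
  induction n generalizing F with
  | zero =>
    simp only [Nat.cast_zero, contDiff_zero] at hF ⊢
    have : ProperSpace X := FiniteDimensional.proper ℝ X
    exact continuous_parametric_integral_of_continuous (f := fun x z => F (x, z)) hF hK
  | succ n ih =>
    have h1 : ContDiff ℝ 1 F := hF.of_le (by exact_mod_cast Nat.le_add_left 1 n)
    rw [Nat.cast_succ, contDiff_succ_iff_fderiv_apply]
    refine ⟨fun x => (hasFDerivAt_setIntegral_of_contDiff hK h1 x).differentiableAt,
      by simp, fun v => ?_⟩
    simp only [fderiv_setIntegral_of_contDiff hK h1]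
    exact ih (contDiff_fderiv_apply_const hF le_rfl (v, 0))

end ParametricIntegrals

/-! ### A radial kernel and integration by parts -/

/-- A radial cutoff `Φ` with `∇Φ(y) = -ρ(y) y`, where `ρ` is again a smooth radial cutoff. -/
theorem exists_radial_kernel : ∃ Φ ρ : R3 → ℝ, (∀ n : ℕ, ContDiff ℝ n Φ) ∧
    (∀ n : ℕ, ContDiff ℝ n ρ) ∧ HasCompactSupport Φ ∧ HasCompactSupport ρ ∧ Φ 0 = 1 ∧
    (∫ y, ρ y) ≠ 0 ∧ ∀ y v, fderiv ℝ Φ y v = -(ρ y * ⟪y, v⟫) := by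
  have hS (n : ℕ) : ContDiff ℝ n Real.smoothTransition :=
    Real.smoothTransition.contDiff (n := (n : ℕ∞))
  have hS' (n : ℕ) : ContDiff ℝ n (deriv Real.smoothTransition) :=
    ((contDiff_succ_iff_deriv (n := n)).1 (by exact_mod_cast hS (n + 1))).2.2
  have hq (n : ℕ) : ContDiff ℝ n (fun y : R3 => 1 - ‖y‖ ^ 2) :=
    contDiff_const.sub (contDiff_norm_sq ℝ)
  have hΦ (n : ℕ) : ContDiff ℝ n (fun y : R3 => Real.smoothTransition (1 - ‖y‖ ^ 2)) :=
    (hS n).comp (hq n)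
  have hρ (n : ℕ) : ContDiff ℝ n (fun y : R3 => 2 * deriv Real.smoothTransition (1 - ‖y‖ ^ 2)) :=
    contDiff_const.mul ((hS' n).comp (hq n))
  have hneg {y : R3} (hy : y ∉ Metric.closedBall (0 : R3) 1) : 1 - ‖y‖ ^ 2 < 0 := by
    have : 1 < ‖y‖ := by simpa using hy
    nlinarith
  have hΦc : HasCompactSupport (fun y : R3 => Real.smoothTransition (1 - ‖y‖ ^ 2)) :=
    HasCompactSupport.intro (isCompact_closedBall 0 1) fun y hy =>
      Real.smoothTransition.zero_of_nonpos (hneg hy).le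
  have hρc : HasCompactSupport
      (fun y : R3 => 2 * deriv Real.smoothTransition (1 - ‖y‖ ^ 2)) := by
    refine HasCompactSupport.intro (isCompact_closedBall 0 1) fun y hy => ?_
    have h : Real.smoothTransition =ᶠ[nhds (1 - ‖y‖ ^ 2)] fun _ => 0 := by
      filter_upwards [Iio_mem_nhds (hneg hy)] with s hs
      exact Real.smoothTransition.zero_of_nonpos (le_of_lt hs)
    simp [h.deriv_eq]
  have hgrad (y v : R3) : fderiv ℝ (fun y : R3 => Real.smoothTransition (1 - ‖y‖ ^ 2)) y v =
      -(2 * deriv Real.smoothTransition (1 - ‖y‖ ^ 2) * ⟪y, v⟫) := by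
    have h1 : HasFDerivAt (fun y : R3 => 1 - ‖y‖ ^ 2) (-(2 • innerSL ℝ y)) y :=
      (hasStrictFDerivAt_norm_sq y).hasFDerivAt.const_sub 1
    have h2 := ((hS 1).differentiable (by norm_num) (1 - ‖y‖ ^ 2)).hasDerivAt.comp_hasFDerivAt y h1
    rw [HasFDerivAt.fderiv (f := fun y : R3 => Real.smoothTransition (1 - ‖y‖ ^ 2)) h2]
    simp
    ring
  refine ⟨_, _, hΦ, hρ, hΦc, hρc, by simp, ?_, hgrad⟩
  obtain ⟨y, hy⟩ : ∃ y : R3, 2 * deriv Real.smoothTransition (1 - ‖y‖ ^ 2) ≠ 0 := by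
    by_contra! h
    have hconst := is_const_of_fderiv_eq_zero (𝕜 := ℝ) ((hΦ 1).differentiable (by norm_num))
      (fun y => by ext v; rw [hgrad, h]; simp) 0 (EuclideanSpace.single 0 1)
    simp at hconst
  refine ((hρ 0).continuous.integral_pos_of_hasCompactSupport_nonneg_nonzero hρc
    (fun y => ?_) hy).ne'
  exact mul_nonneg zero_le_two Real.smoothTransition.monotone.deriv_nonneg

theorem integral_mul_fderiv_of_hasCompactSupport {ψ q : R3 → ℝ} (hψ : ContDiff ℝ 1 ψ)
    (hc : HasCompactSupport ψ) (hq : ContDiff ℝ 1 q) (v : R3) :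
    ∫ y, ψ y * fderiv ℝ q y v = -∫ y, fderiv ℝ ψ y v * q y := by
  have hψ' := (hψ.continuous_fderiv (by norm_num)).clm_apply (continuous_const (y := v))
  have hq' := (hq.continuous_fderiv (by norm_num)).clm_apply (continuous_const (y := v))
  exact integral_mul_fderiv_eq_neg_fderiv_mul_of_integrable
    ((hψ'.mul hq.continuous).integrable_of_hasCompactSupport (hc.fderiv_apply ℝ v).mul_right)
    ((hψ.continuous.mul hq').integrable_of_hasCompactSupport hc.mul_right)
    ((hψ.continuous.mul hq.continuous).integrable_of_hasCompactSupport hc.mul_right)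
    (fun x _ => hψ.differentiable (by norm_num) x) (fun x _ => hq.differentiable (by norm_num) x)

theorem integral_fderiv_mul_fderiv_comm {ψ q : R3 → ℝ} (hψ : ContDiff ℝ 2 ψ)
    (hc : HasCompactSupport ψ) (hq : ContDiff ℝ 1 q) (v w : R3) :
    ∫ y, fderiv ℝ ψ y v * fderiv ℝ q y w = ∫ y, fderiv ℝ ψ y w * fderiv ℝ q y v := by
  have hψ' (v : R3) : ContDiff ℝ 1 fun y => fderiv ℝ ψ y v :=
    contDiff_fderiv_apply_const (n := 2) (m := 1) hψ (by norm_num) v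
  rw [integral_mul_fderiv_of_hasCompactSupport (hψ' v) (hc.fderiv_apply ℝ v) hq,
    integral_mul_fderiv_of_hasCompactSupport (hψ' w) (hc.fderiv_apply ℝ w) hq]
  simp only [fderiv_fderiv_comm hψ _ v w]

/-! ### Regularity: a `C²` function with `C²` Laplacian is `C³` -/

theorem setIntegral_tsupport_mul (h f : R3 → ℝ) :
    ∫ y in tsupport h, h y * f y = ∫ y, h y * f y :=
  setIntegral_eq_integral_of_forall_compl_eq_zero fun y hy => by
    rw [image_eq_zero_of_notMem_tsupport hy, zero_mul]

theorem fderiv_comp_sub_smul {q : R3 → ℝ} (hq : ContDiff ℝ 1 q) (x : R3) (t : ℝ) (y v : R3) :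
    fderiv ℝ (fun y => q (x - t • y)) y v = -(t * fderiv ℝ q (x - t • y) v) := by
  have h : HasFDerivAt (fun y : R3 => x - t • y) (-(t • ContinuousLinearMap.id ℝ R3)) y :=
    ((hasFDerivAt_id y).const_smul t).const_sub x
  rw [HasFDerivAt.fderiv (f := fun y => q (x - t • y))
    ((hq.differentiable (by norm_num) (x - t • y)).hasFDerivAt.comp y h)]
  simp

theorem integral_fderiv_mul_fderiv_comp_comm {Φ q : R3 → ℝ} (hΦ : ContDiff ℝ 2 Φ)
    (hc : HasCompactSupport Φ) (hq : ContDiff ℝ 1 q) (x v w : R3) {t : ℝ} (ht : t ≠ 0) :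
    ∫ y, fderiv ℝ Φ y v * fderiv ℝ q (x - t • y) w =
      ∫ y, fderiv ℝ Φ y w * fderiv ℝ q (x - t • y) v := by
  have h := integral_fderiv_mul_fderiv_comm hΦ hc
    (hq.comp (by fun_prop : ContDiff ℝ 1 fun y : R3 => x - t • y)) v w
  simp only [Function.comp_def, fderiv_comp_sub_smul hq, mul_neg, mul_left_comm _ t,
    integral_neg, integral_const_mul, neg_inj] at h
  exact mul_left_cancel₀ ht h

/-- The derivative in `t` of the averages `∫ ρ(y) ∂ᵥu(x - t y) dy`, expressed through the
Laplacian. -/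
theorem hasDerivAt_integral_kernel {Φ ρ u : R3 → ℝ} (hΦ : ContDiff ℝ 2 Φ) (hρ : ContDiff ℝ 1 ρ)
    (hΦc : HasCompactSupport Φ) (hρc : HasCompactSupport ρ)
    (hgrad : ∀ y v, fderiv ℝ Φ y v = -(ρ y * ⟪y, v⟫)) (hu : ContDiff ℝ 2 u) (x v : R3)
    {t : ℝ} (ht : t ≠ 0) :
    HasDerivAt (fun t : ℝ => ∫ y, ρ y * fderiv ℝ u (x - t • y) v)
      (∫ y, fderiv ℝ Φ y v * lap u (x - t • y)) t := by
  have hw (v : R3) : ContDiff ℝ 1 fun y => fderiv ℝ u y v :=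
    contDiff_fderiv_apply_const (n := 2) (m := 1) hu (by norm_num) v
  have hF : ContDiff ℝ 1 fun p : ℝ × R3 => ρ p.2 * fderiv ℝ u (x - p.1 • p.2) v :=
    (hρ.comp contDiff_snd).mul
      ((hw v).comp (by fun_prop : ContDiff ℝ 1 fun p : ℝ × R3 => x - p.1 • p.2))
  have hV := (hasFDerivAt_setIntegral_of_contDiff (μ := volume) hρc hF t).differentiableAt
  have hd := hV.hasDerivAt
  rw [← fderiv_apply_one_eq_deriv, fderiv_setIntegral_of_contDiff hρc hF] at hd
  simp only [setIntegral_tsupport_mul] at hd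
  refine hd.congr_deriv ?_
  have hpt (y : R3) : fderiv ℝ (fun p : ℝ × R3 => ρ p.2 * fderiv ℝ u (x - p.1 • p.2) v)
      (t, y) (1, 0) = ∑ i : Fin 3, fderiv ℝ Φ y (EuclideanSpace.single i 1) *
        fderiv ℝ (fun z => fderiv ℝ u z (EuclideanSpace.single i 1)) (x - t • y) v := by
    have h1 : HasDerivAt (fun s : ℝ => (s, y)) ((1 : ℝ), (0 : R3)) t :=
      (hasDerivAt_id t).prodMk (hasDerivAt_const t y)
    have h2 := (hF.differentiable (by norm_num) (t, y)).hasFDerivAt.comp_hasDerivAt t h1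
    have h3 : HasDerivAt (fun s : ℝ => x - s • y) (-((1 : ℝ) • y)) t :=
      ((hasDerivAt_id t).smul_const y).const_sub x
    have h4 := (((hw v).differentiable (by norm_num) (x - t • y)).hasFDerivAt.comp_hasDerivAt
      t h3).const_mul (ρ y)
    rw [h2.unique h4, one_smul, map_neg, clm_apply_eq_sum _ y, mul_neg, Finset.mul_sum,
      ← Finset.sum_neg_distrib]
    refine Finset.sum_congr rfl fun i _ => ?_
    rw [hgrad, fderiv_fderiv_comm hu _ _ v]
    simp [EuclideanSpace.inner_single_right]
    ring
  have hint {a : R3} {g : R3 → ℝ} (hg : Continuous g) :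
      Integrable fun y => fderiv ℝ Φ y a * g (x - t • y) :=
    (((hΦ.continuous_fderiv (by norm_num)).clm_apply continuous_const).mul
      (hg.comp (by fun_prop))).integrable_of_hasCompactSupport (hΦc.fderiv_apply ℝ a).mul_right
  have hww (v w : R3) : Continuous fun z => fderiv ℝ (fun y => fderiv ℝ u y v) z w :=
    ((hw v).continuous_fderiv (by norm_num)).clm_apply continuous_const
  have hzero {y : R3} (hy : y ∉ tsupport ρ) (a : R3) : fderiv ℝ Φ y a = 0 := by
    rw [hgrad, image_eq_zero_of_notMem_tsupport hy]; simp
  simp only [hpt, lap, Finset.mul_sum]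
  rw [setIntegral_eq_integral_of_forall_compl_eq_zero fun y hy => by simp [hzero hy],
    integral_finsetSum _ fun i _ => hint (hww _ _), integral_finsetSum _ fun i _ => hint (hww _ _)]
  exact Finset.sum_congr rfl fun i _ =>
    integral_fderiv_mul_fderiv_comp_comm hΦ hΦc (hw _) x _ v ht

theorem contDiff_integral_comp_sub_smul {h g : R3 → ℝ} {n : ℕ} (hh : ContDiff ℝ n h)
    (hc : HasCompactSupport h) (hg : ContDiff ℝ n g) :
    ContDiff ℝ n fun p : R3 × ℝ => ∫ y, h y * g (p.1 - p.2 • y) := by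
  rw [← funext fun p : R3 × ℝ => setIntegral_tsupport_mul h fun y => g (p.1 - p.2 • y)]
  exact contDiff_setIntegral (X := R3 × ℝ) hc n
    (F := fun q : (R3 × ℝ) × R3 => h q.2 * g (q.1.1 - q.1.2 • q.2))
    ((hh.comp contDiff_snd).mul (hg.comp (by fun_prop)))

theorem contDiff_three_of_contDiff_two_lap {u : R3 → ℝ} (hu : ContDiff ℝ 2 u)
    (hlap : ContDiff ℝ 2 (lap u)) : ContDiff ℝ 3 u := by
  obtain ⟨Φ, ρ, hΦ, hρ, hΦc, hρc, -, hρ0, hgrad⟩ := exists_radial_kernel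
  rw [show (3 : WithTop ℕ∞) = 2 + 1 by norm_num, contDiff_succ_iff_fderiv_apply]
  refine ⟨hu.differentiable (by norm_num), by simp, fun v => ?_⟩
  have hw : ContDiff ℝ 1 fun y => fderiv ℝ u y v :=
    contDiff_fderiv_apply_const (n := 2) (m := 1) hu (by norm_num) v
  have hΦv (n : ℕ) : ContDiff ℝ n fun y => fderiv ℝ Φ y v :=
    contDiff_fderiv_apply_const (hΦ (n + 1)) le_rfl v
  have hG : ContDiff ℝ 2 fun p : R3 × ℝ => ∫ y, fderiv ℝ Φ y v * lap u (p.1 - p.2 • y) :=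
    contDiff_integral_comp_sub_smul (n := 2) (hΦv 2) (hΦc.fderiv_apply ℝ v) hlap
  have hV : ContDiff ℝ 1 fun p : R3 × ℝ => ∫ y, ρ y * fderiv ℝ u (p.1 - p.2 • y) v :=
    contDiff_integral_comp_sub_smul (n := 1) (hρ 1) hρc hw
  have hformula (x : R3) : fderiv ℝ u x v = (∫ y, ρ y)⁻¹ * ((∫ y, ρ y * fderiv ℝ u (x - y) v) -
      ∫ t in Set.Icc (0 : ℝ) 1, ∫ y, fderiv ℝ Φ y v * lap u (x - t • y)) := by
    have hGx : Continuous fun t : ℝ => ∫ y, fderiv ℝ Φ y v * lap u (x - t • y) :=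
      hG.continuous.comp (by fun_prop : Continuous fun t : ℝ => (x, t))
    have hVx : Continuous fun t : ℝ => ∫ y, ρ y * fderiv ℝ u (x - t • y) v :=
      hV.continuous.comp (by fun_prop : Continuous fun t : ℝ => (x, t))
    have hftc := intervalIntegral.integral_eq_sub_of_hasDerivAt_of_le zero_le_one
      hVx.continuousOn
      (fun t ht => hasDerivAt_integral_kernel (hΦ 2) (by exact_mod_cast hρ 1) hΦc hρc hgrad hu x v
        ht.1.ne')
      (hGx.intervalIntegrable 0 1)
    rw [intervalIntegral.integral_of_le zero_le_one, ← integral_Icc_eq_integral_Ioc] at hftc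
    simp only [one_smul, zero_smul, sub_zero, integral_mul_const] at hftc
    rw [hftc]
    field_simp
    ring
  simp only [funext hformula]
  have hconv : ContDiff ℝ 2 fun x => ∫ y, ρ y * fderiv ℝ u (x - y) v :=
    hρc.contDiff_convolution_left (n := 2) (ContinuousLinearMap.mul ℝ ℝ) (hρ 2)
      hw.continuous.locallyIntegrable
  exact contDiff_const.mul (hconv.sub (contDiff_setIntegral isCompact_Icc 2 hG))

/-! ### The energy identity and the kernel equation -/

/-- The Laplacian of the radial derivative: `Δ(x · ∇u) = 2Δu + x · ∇(Δu)`. -/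
theorem lap_fderiv_apply_self {u : R3 → ℝ} (hu : ContDiff ℝ 3 u) (x : R3) :
    lap (fun y => fderiv ℝ u y y) x = 2 * lap u x + fderiv ℝ (lap u) x x := by
  have hu2 : ContDiff ℝ 2 u := hu.of_le (by norm_num)
  have h2 (v : R3) : ContDiff ℝ 2 fun y => fderiv ℝ u y v :=
    contDiff_fderiv_apply_const (n := 3) (m := 2) hu (by norm_num) v
  have h1 (v w : R3) : ContDiff ℝ 1 fun z => fderiv ℝ (fun y => fderiv ℝ u y v) z w :=
    contDiff_fderiv_apply_const (n := 2) (m := 1) (h2 v) (by norm_num) w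
  have hE (v : R3) : Differentiable ℝ fun y => fderiv ℝ (fun z => fderiv ℝ u z v) y y :=
    (((h2 v).fderiv_right (m := 1) (by norm_num)).clm_apply contDiff_id).differentiable
      (by norm_num)
  have hlap : fderiv ℝ (lap u) x = ∑ i : Fin 3, fderiv ℝ (fun z => fderiv ℝ (fun y =>
      fderiv ℝ u y (EuclideanSpace.single i 1)) z (EuclideanSpace.single i 1)) x :=
    fderiv_fun_sum fun i _ => (h1 _ _).differentiable (by norm_num) x
  rw [hlap, sum_apply]
  simp only [lap, Finset.mul_sum, ← Finset.sum_add_distrib]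
  refine Finset.sum_congr rfl fun i _ => ?_
  simp only [fderiv_fderiv_apply_self hu2]
  rw [fderiv_fun_add ((h2 _).differentiable (by norm_num) x) (hE _ x), add_apply,
    fderiv_fderiv_apply_self (h2 _)]
  ring

/-- `div (x f) = 3 f + x · ∇f` has vanishing integral when both it and `f` are integrable. -/
theorem integral_three_mul_add_fderiv_apply_self {f : R3 → ℝ} (hf : ContDiff ℝ 1 f)
    (hint : Integrable f) (hdiv : Integrable fun x => 3 * f x + fderiv ℝ f x x) :
    ∫ x, 3 * f x + fderiv ℝ f x x = 0 := by
  obtain ⟨Φ, -, hΦ, -, hΦc, -, hΦ0, -⟩ := exists_radial_kernel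
  have hΦ1 : ContDiff ℝ 1 Φ := hΦ 1
  have hEΦ : Continuous fun y => fderiv ℝ Φ y y :=
    (hΦ1.continuous_fderiv (by norm_num)).clm_apply continuous_id
  have hEΦc : HasCompactSupport fun y => fderiv ℝ Φ y y :=
    (hΦc.fderiv ℝ).mono fun y hy h => hy (by simp [h])
  have hscale {c : ℝ} (hc : 0 < c) : ∫ x, Φ (c • x) * (3 * f x + fderiv ℝ f x x) =
      -∫ x, fderiv ℝ Φ (c • x) (c • x) * f x := by
    have hψ : ContDiff ℝ 1 fun x => Φ (c • x) := hΦ1.comp (contDiff_const_smul c)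
    have hψc : HasCompactSupport fun x => Φ (c • x) := hΦc.comp_smul hc.ne'
    have hψ' (x v : R3) : fderiv ℝ (fun x => Φ (c • x)) x v = fderiv ℝ Φ (c • x) (c • v) := by
      rw [fderiv_comp_smul]; simp
    have hcoord (i : Fin 3) : ContDiff ℝ 1 fun x : R3 => x i := by fun_prop
    have hibp (i : Fin 3) := integral_mul_fderiv_of_hasCompactSupport
      (hψ.mul (hcoord i)) hψc.mul_right hf (EuclideanSpace.single i 1)
    have hprod (i : Fin 3) (x : R3) : fderiv ℝ (fun x : R3 => Φ (c • x) * x i) x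
        (EuclideanSpace.single i 1) =
        x i * fderiv ℝ (fun x => Φ (c • x)) x (EuclideanSpace.single i 1) + Φ (c • x) := by
      have hx : HasFDerivAt (fun x : R3 => x i) (EuclideanSpace.proj (𝕜 := ℝ) i) x :=
        (EuclideanSpace.proj (𝕜 := ℝ) i).hasFDerivAt
      rw [((hψ.differentiable (by norm_num) x).hasFDerivAt.fun_mul hx).fderiv]
      simp
      ring
    have hψ'i (v : R3) : Continuous fun x => fderiv ℝ (fun x => Φ (c • x)) x v :=
      (hψ.continuous_fderiv (by norm_num)).clm_apply continuous_const
    have hf' (v : R3) : Continuous fun x => fderiv ℝ f x v :=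
      (hf.continuous_fderiv (by norm_num)).clm_apply continuous_const
    have hi1 (i : Fin 3) : Integrable fun x : R3 =>
        Φ (c • x) * x i * fderiv ℝ f x (EuclideanSpace.single i 1) :=
      ((hψ.continuous.mul (hcoord i).continuous).mul (hf' _)).integrable_of_hasCompactSupport
        hψc.mul_right.mul_right
    have hi2 (i : Fin 3) : Integrable fun x : R3 => fderiv ℝ (fun x : R3 => Φ (c • x) * x i) x
        (EuclideanSpace.single i 1) * f x :=
      ((((hψ.mul (hcoord i)).continuous_fderiv (by norm_num)).clm_apply
        continuous_const).mul hf.continuous).integrable_of_hasCompactSupport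
        ((hψc.mul_right (f' := fun x : R3 => x i)).fderiv_apply ℝ _).mul_right
    have hi3 : Integrable fun x => Φ (c • x) * (3 * f x) :=
      (hψ.continuous.mul (continuous_const.mul hf.continuous)).integrable_of_hasCompactSupport
        hψc.mul_right
    have hsum := Finset.sum_congr rfl fun i (_ : i ∈ Finset.univ) => hibp i
    rw [Finset.sum_neg_distrib, ← integral_finsetSum _ fun i _ => hi1 i,
      ← integral_finsetSum _ fun i _ => hi2 i] at hsum
    have hl (x : R3) : Φ (c • x) * fderiv ℝ f x x =
        ∑ i : Fin 3, Φ (c • x) * x i * fderiv ℝ f x (EuclideanSpace.single i 1) := by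
      rw [clm_apply_eq_sum _ x, Finset.mul_sum]
      simp only [mul_assoc]
    have hr (x : R3) : fderiv ℝ Φ (c • x) (c • x) * f x + Φ (c • x) * (3 * f x) =
        ∑ i : Fin 3, fderiv ℝ (fun x : R3 => Φ (c • x) * x i) x
          (EuclideanSpace.single i 1) * f x := by
      simp only [hprod]
      rw [← hψ' x x, clm_apply_eq_sum _ x, Fin.sum_univ_three, Fin.sum_univ_three]
      ring
    simp only [← hl, ← hr] at hsum
    have hi4 : Integrable fun x => fderiv ℝ Φ (c • x) (c • x) * f x :=
      ((hEΦ.comp (continuous_const_smul c)).mul hf.continuous).integrable_of_hasCompactSupport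
        (hEΦc.comp_smul hc.ne').mul_right
    have hi5 : Integrable fun x => Φ (c • x) * fderiv ℝ f x x := by
      simp only [hl]
      exact integrable_finsetSum _ fun i _ => hi1 i
    simp only [mul_add]
    rw [integral_add hi3 hi5, hsum, integral_add hi4 hi3]
    ring
  have hc0 : Filter.Tendsto (fun n : ℕ => 1 / ((n : ℝ) + 1)) Filter.atTop (nhds 0) :=
    tendsto_one_div_add_atTop_nhds_zero_nat
  have hlim {h g : R3 → ℝ} (hh : Continuous h) (hhc : HasCompactSupport h) (hg : Integrable g) :
      Filter.Tendsto (fun n : ℕ => ∫ x, h ((1 / ((n : ℝ) + 1)) • x) * g x) Filter.atTop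
        (nhds (∫ x, h 0 * g x)) := by
    obtain ⟨C, hC⟩ := hh.bounded_above_of_compact_support hhc
    refine tendsto_integral_of_dominated_convergence (fun x => C * ‖g x‖)
      (fun n => (hh.comp (continuous_const_smul _)).aestronglyMeasurable.mul
        hg.aestronglyMeasurable) (hg.norm.const_mul C)
      (fun n => Filter.Eventually.of_forall fun x => ?_) (Filter.Eventually.of_forall fun x => ?_)
    · rw [norm_mul]
      exact mul_le_mul_of_nonneg_right (hC _) (norm_nonneg _)
    · refine Filter.Tendsto.mul_const _ ((hh.tendsto 0).comp ?_)
      simpa using hc0.smul_const x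
  have h1 := hlim hΦ1.continuous hΦc hdiv
  have h2 := (hlim hEΦ hEΦc hint).neg
  simp only [hscale (Nat.one_div_pos_of_nat (α := ℝ))] at h1
  simpa [hΦ0] using tendsto_nhds_unique h1 h2

theorem inner_gradient_eq_sum {u v : R3 → ℝ} (x : R3) :
    ⟪gradient u x, gradient v x⟫ = ∑ i : Fin 3, fderiv ℝ u x (EuclideanSpace.single i 1) *
      fderiv ℝ v x (EuclideanSpace.single i 1) := by
  rw [inner_gradient_left, clm_apply_eq_sum]
  refine Finset.sum_congr rfl fun i _ => ?_
  rw [← inner_gradient_left (f := v), EuclideanSpace.inner_single_right]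
  simp [mul_comm]

theorem fderiv_scaling_generator {u : R3 → ℝ} (hu : ContDiff ℝ 2 u) (x v : R3) :
    fderiv ℝ (fun x => u x / 2 + fderiv ℝ u x x) x v =
      1 / 2 * fderiv ℝ u x v + fderiv ℝ (fun y => fderiv ℝ u y y) x v := by
  have hE : Differentiable ℝ fun x => fderiv ℝ u x x :=
    ((hu.fderiv_right (m := 1) (by norm_num)).clm_apply contDiff_id).differentiable (by norm_num)
  have hud : Differentiable ℝ u := hu.differentiable (by norm_num)
  simp only [div_eq_inv_mul]
  rw [fderiv_fun_add ((hud x).const_mul _) (hE x), add_apply, fderiv_const_mul (hud x)]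
  simp

/-- Orthogonality of `u` and its scaling generator in the Dirichlet inner product. -/
theorem integral_inner_gradient_scaling_generator {u : R3 → ℝ} (hu : ContDiff ℝ 2 u)
    (hfin : Integrable fun x : R3 => ‖gradient u x‖ ^ 2) :
    ∫ y, ⟪gradient u y, gradient (fun x => u x / 2 + fderiv ℝ u x x) y⟫ = 0 := by
  have hw (v : R3) : ContDiff ℝ 1 fun y => fderiv ℝ u y v :=
    contDiff_fderiv_apply_const (n := 2) (m := 1) hu (by norm_num) v
  have hsq : (fun x : R3 => ‖gradient u x‖ ^ 2) =
      fun x => ∑ i : Fin 3, fderiv ℝ u x (EuclideanSpace.single i 1) ^ 2 := by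
    ext x
    rw [← real_inner_self_eq_norm_sq, inner_gradient_eq_sum]
    simp only [sq]
  have hf : ContDiff ℝ 1 fun x : R3 => ‖gradient u x‖ ^ 2 := by
    rw [hsq]
    exact ContDiff.sum fun i _ => (hw _).pow 2
  have hpt (x : R3) : ⟪gradient u x, gradient (fun x => u x / 2 + fderiv ℝ u x x) x⟫ =
      (1 / 2) * (3 * ‖gradient u x‖ ^ 2 + fderiv ℝ (fun x => ‖gradient u x‖ ^ 2) x x) := by
    have hd : fderiv ℝ (fun x => ‖gradient u x‖ ^ 2) x x = ∑ i : Fin 3,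
        2 * fderiv ℝ u x (EuclideanSpace.single i 1) *
          fderiv ℝ (fun y => fderiv ℝ u y (EuclideanSpace.single i 1)) x x := by
      rw [hsq, fderiv_fun_sum fun i _ => ((hw _).pow 2).differentiable (by norm_num) x,
        sum_apply]
      refine Finset.sum_congr rfl fun i _ => ?_
      rw [fderiv_fun_pow 2 ((hw _).differentiable (by norm_num) x)]
      simp
    rw [inner_gradient_eq_sum, hd, congrFun hsq x]
    have he (v : R3) : fderiv ℝ (fun x => u x / 2 + fderiv ℝ u x x) x v =
        3 / 2 * fderiv ℝ u x v + fderiv ℝ (fun y => fderiv ℝ u y v) x x := by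
      rw [fderiv_scaling_generator hu, fderiv_fderiv_apply_self hu]
      ring
    simp only [he, Fin.sum_univ_three]
    ring
  simp only [hpt, integral_const_mul]
  by_cases hdiv : Integrable fun x : R3 =>
      3 * ‖gradient u x‖ ^ 2 + fderiv ℝ (fun x => ‖gradient u x‖ ^ 2) x x
  · rw [integral_three_mul_add_fderiv_apply_self hf hfin hdiv, mul_zero]
  · rw [integral_undef hdiv, mul_zero]

/-- if `u` is a positive finite-energy `C²` solution of the Kirchhoff equation,
then `e₀(x) = u(x)/2 + x·∇u(x)` lies in the kernel of the linearized operator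
`L₊φ = -(a + b∫|∇u|²)Δφ - 2b(∫∇u·∇φ)Δu - 5u⁴φ`. -/
theorem scaling_generator_in_kernel (a b : ℝ) (ha : 0 < a) (hb : 0 < b)
    (u : R3 → ℝ) (hpos : ∀ x, 0 < u x) (hreg : ContDiff ℝ 2 u)
    (hfin : Integrable (fun x : R3 => ‖gradient u x‖ ^ 2))
    (heq : ∀ x, -((a + b * ∫ y : R3, ‖gradient u y‖ ^ 2) * lap u x) = u x ^ 5)
    (e₀ : R3 → ℝ) (he : ∀ x, e₀ x = u x / 2 + ⟪x, gradient u x⟫) :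
    ∀ x, -((a + b * ∫ y : R3, ‖gradient u y‖ ^ 2) * lap e₀ x)
      - 2 * b * (∫ y : R3, ⟪gradient u y, gradient e₀ y⟫) * lap u x
      - 5 * u x ^ 4 * e₀ x = 0 := by
  set c := a + b * ∫ y : R3, ‖gradient u y‖ ^ 2 with hc
  have hcpos : 0 < c := add_pos_of_pos_of_nonneg ha
    (mul_nonneg hb.le (integral_nonneg fun y => sq_nonneg _))
  have hlap : lap u = fun x => -c⁻¹ * u x ^ 5 := by
    ext x
    rw [← heq x]
    field_simp
  have hu3 : ContDiff ℝ 3 u :=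
    contDiff_three_of_contDiff_two_lap hreg (hlap ▸ contDiff_const.mul (hreg.pow 5))
  have he₀ : e₀ = fun x => u x / 2 + fderiv ℝ u x x := by
    ext x
    rw [he, real_inner_comm, inner_gradient_left]
  have hE : ContDiff ℝ 2 fun x => fderiv ℝ u x x :=
    (hu3.fderiv_right (m := 2) (by norm_num)).clm_apply contDiff_id
  have hlap_e₀ (x : R3) : lap e₀ x = lap u x / 2 + lap (fun y => fderiv ℝ u y y) x := by
    have h2 (v y : R3) : fderiv ℝ e₀ y v =
        1 / 2 * fderiv ℝ u y v + fderiv ℝ (fun z => fderiv ℝ u z z) y v := by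
      rw [he₀, fderiv_scaling_generator hreg]
    have hd {f : R3 → ℝ} (hf : ContDiff ℝ 2 f) (v : R3) :
        DifferentiableAt ℝ (fun y => fderiv ℝ f y v) x :=
      (contDiff_fderiv_apply_const (n := 2) (m := 1) hf (by norm_num) v).differentiable
        (by norm_num) x
    simp only [lap, h2, Finset.sum_div, ← Finset.sum_add_distrib]
    refine Finset.sum_congr rfl fun i _ => ?_
    rw [fderiv_fun_add ((hd hreg _).const_mul _) (hd hE _), add_apply,
      fderiv_const_mul (hd hreg _)]
    simp
    ring
  have hdlap (x : R3) : fderiv ℝ (lap u) x x = -c⁻¹ * (5 * u x ^ 4 * fderiv ℝ u x x) := by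
    have hud := hreg.differentiable (by norm_num) x
    rw [hlap, fderiv_const_mul (hud.fun_pow 5), fderiv_fun_pow 5 hud]
    simp
  intro x
  have horth : ∫ y : R3, ⟪gradient u y, gradient e₀ y⟫ = 0 :=
    he₀ ▸ integral_inner_gradient_scaling_generator hreg hfin
  rw [horth, hlap_e₀, lap_fderiv_apply_self hu3, hdlap, congrFun hlap x, he₀]
  field_simp
  ring
end
end
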